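/- For every integer n ≥ 2 there exist constants C > 0 and δ ∈ (0, 1), depending only on n, with the following property: for every odd positive integer m, every real μ ∈ [m + 1 − δ, m + 1], and every Legendre function p for the pair (n, μ), one has p(0) ≠ 0 and 0 ≤ −p'(0)/p(0) ≤ C · m · (m + 1 − μ). -/

import Mathlib

open Real Set Filter

/-- `p` is a Legendre function for the pair `(n, μ)`, with derivative `p'` (denoted `p₁`):
`p` is `C¹` on `[0, π/2]`, `C²` on `[0, π/2)`, solves
`p'' - (n-2)·tan(φ)·p' + μ(μ+n-2)·p = 0` on `[0, π/2)`, and `p(π/2) = 1`, `p'(π/2) = 0`. -/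
def IsLegendre (n : ℕ) (μ : ℝ) (p p₁ : ℝ → ℝ) : Prop :=
  (∀ φ ∈ Set.Icc (0 : ℝ) (π / 2), HasDerivWithinAt p (p₁ φ) (Set.Icc 0 (π / 2)) φ) ∧
  ContinuousOn p₁ (Set.Icc 0 (π / 2)) ∧
  (∃ p₂ : ℝ → ℝ,
    (∀ φ ∈ Set.Ico (0 : ℝ) (π / 2), HasDerivWithinAt p₁ (p₂ φ) (Set.Ico 0 (π / 2)) φ) ∧
    ContinuousOn p₂ (Set.Ico 0 (π / 2)) ∧
    ∀ φ ∈ Set.Ico (0 : ℝ) (π / 2),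
      p₂ φ - (n - 2 : ℝ) * Real.tan φ * p₁ φ + μ * (μ + n - 2) * p φ = 0) ∧
  p (π / 2) = 1 ∧ p₁ (π / 2) = 0

/-- Ladder operator lowering `μ` by one. -/
lemma legendre_ladder (k : ℕ) (μ : ℝ) (hμ : μ ≠ 0) (p p₁ : ℝ → ℝ)
    (h : IsLegendre (k + 2) μ p p₁) :
    IsLegendre (k + 2) (μ - 1) (fun φ => Real.sin φ * p φ + Real.cos φ * p₁ φ / μ)
      (fun φ => (μ + k - 1) * (Real.sin φ * p₁ φ / μ - Real.cos φ * p φ)) := by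
  obtain ⟨hp, hc1, ⟨p₂, hp1, hc2, hode⟩, h1, h0⟩ := h
  have hcp : ContinuousOn p (Icc 0 (π / 2)) := fun x hx => (hp x hx).continuousWithinAt
  have hsub : Ico (0 : ℝ) (π / 2) ⊆ Icc 0 (π / 2) := Ico_subset_Icc_self
  have hcos : ∀ φ ∈ Ico (0 : ℝ) (π / 2), Real.cos φ ≠ 0 := fun φ hφ =>
    (Real.cos_pos_of_mem_Ioo ⟨by linarith [hφ.1, Real.pi_pos], hφ.2⟩).ne'
  have hode' : ∀ φ ∈ Ico (0 : ℝ) (π / 2),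
      Real.cos φ * p₂ φ = k * Real.sin φ * p₁ φ - μ * (μ + k) * p φ * Real.cos φ := by
    intro φ hφ
    have := hode φ hφ
    have hc := hcos φ hφ
    rw [Real.tan_eq_sin_div_cos] at this
    push_cast at this
    field_simp at this
    linear_combination this
  -- derivative of the first function on `Ico`
  have hr : ∀ φ ∈ Ico (0 : ℝ) (π / 2),
      HasDerivWithinAt (fun φ => Real.sin φ * p φ + Real.cos φ * p₁ φ / μ)
        ((μ + k - 1) * (Real.sin φ * p₁ φ / μ - Real.cos φ * p φ)) (Ico 0 (π / 2)) φ := by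
    intro φ hφ
    have e := (((Real.hasDerivAt_sin φ).hasDerivWithinAt (s := Ico 0 (π / 2))).mul
      ((hp φ (hsub hφ)).mono hsub)).add
      ((((Real.hasDerivAt_cos φ).hasDerivWithinAt (s := Ico 0 (π / 2))).mul
      (hp1 φ hφ)).div_const μ)
    refine e.congr_deriv ?_
    have := hode' φ hφ
    field_simp
    linear_combination this
  have hcr : ContinuousOn (fun φ => Real.sin φ * p φ + Real.cos φ * p₁ φ / μ)
      (Icc 0 (π / 2)) := by fun_prop
  have hcr1 : ContinuousOn (fun φ => (μ + k - 1) * (Real.sin φ * p₁ φ / μ - Real.cos φ * p φ))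
      (Icc 0 (π / 2)) := by fun_prop
  have hpi : (0 : ℝ) < π / 2 := by positivity
  have hrI : ∀ φ ∈ Ioo (0 : ℝ) (π / 2),
      HasDerivAt (fun φ => Real.sin φ * p φ + Real.cos φ * p₁ φ / μ)
        ((μ + k - 1) * (Real.sin φ * p₁ φ / μ - Real.cos φ * p φ)) φ := fun φ hφ =>
    (hr φ ⟨hφ.1.le, hφ.2⟩).hasDerivAt (Ico_mem_nhds hφ.1 hφ.2)
  refine ⟨?_, hcr1, ⟨fun φ => (μ + k - 1) * ((Real.cos φ * p₁ φ + Real.sin φ * p₂ φ) / μ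
      - (-Real.sin φ * p φ + Real.cos φ * p₁ φ)), ?_, ?_, ?_⟩, ?_, ?_⟩
  · intro φ hφ
    rcases eq_or_lt_of_le hφ.2 with he | hlt
    · subst he
      have := hasDerivWithinAt_Iic_of_tendsto_deriv (s := Ioo 0 (π / 2))
        (f := fun φ => Real.sin φ * p φ + Real.cos φ * p₁ φ / μ) (a := π / 2)
        (e := (μ + k - 1) * (Real.sin (π / 2) * p₁ (π / 2) / μ - Real.cos (π / 2) * p (π / 2)))
        (fun x hx => (hrI x hx).differentiableAt.differentiableWithinAt)
        ((hcr (π / 2) hφ).mono Ioo_subset_Icc_self) (Ioo_mem_nhdsLT hpi) (by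
          have t : Tendsto _ _ _ := (hcr1 (π / 2) hφ).mono Ioo_subset_Icc_self
          rw [nhdsWithin_Ioo_eq_nhdsLT hpi] at t
          refine t.congr' ?_
          filter_upwards [Ioo_mem_nhdsLT hpi] with x hx
          exact (hrI x hx).deriv.symm)
      exact this.mono Icc_subset_Iic_self
    · refine (hr φ ⟨hφ.1, hlt⟩).mono_of_mem_nhdsWithin ?_
      filter_upwards [self_mem_nhdsWithin, mem_nhdsWithin_of_mem_nhds (Iio_mem_nhds hlt)]
        with x hx hx2
      exact ⟨hx.1, hx2⟩
  · intro φ hφ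
    exact (((((Real.hasDerivAt_sin φ).hasDerivWithinAt (s := Ico 0 (π / 2))).mul
      (hp1 φ hφ)).div_const μ).sub
      (((Real.hasDerivAt_cos φ).hasDerivWithinAt (s := Ico 0 (π / 2))).mul
      ((hp φ (hsub hφ)).mono hsub))).const_mul _
  · have := hcp.mono hsub
    have := hc1.mono hsub
    fun_prop
  · intro φ hφ
    have := hode' φ hφ
    have hc := hcos φ hφ
    have hs := Real.sin_sq_add_cos_sq φ
    rw [Real.tan_eq_sin_div_cos]
    push_cast
    field_simp
    linear_combination (μ + k - 1) * Real.sin φ * this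
  · simp [h1]
  · simp [h0]

/-- Base case: `r` Legendre for `ν ∈ [1/2,1]`. -/
lemma legendre_base (k : ℕ) (ν : ℝ) (h12 : 1 / 2 ≤ ν) (h1 : ν ≤ 1) (r r₁ : ℝ → ℝ)
    (h : IsLegendre (k + 2) ν r r₁) :
    0 ≤ r 0 ∧ r 0 ≤ (k + 2) * (1 - ν) * (π / 2) ∧ ν * (ν + k) / (k + 1) ≤ r₁ 0 := by
  obtain ⟨hp, hc1, ⟨p₂, hp1, hc2, hode⟩, hr1, hr0⟩ := h
  have hcp : ContinuousOn r (Icc 0 (π / 2)) := fun x hx => (hp x hx).continuousWithinAt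
  have hpi : (0 : ℝ) < π / 2 := by positivity
  have hk : (0 : ℝ) ≤ k := Nat.cast_nonneg k
  have hI : ∀ a, interior (Icc a (π / 2)) = Ioo a (π / 2) := fun a => interior_Icc
  have hd : ∀ φ ∈ Ioo (0 : ℝ) (π / 2), HasDerivAt r (r₁ φ) φ := fun φ hφ =>
    (hp φ ⟨hφ.1.le, hφ.2.le⟩).hasDerivAt (Icc_mem_nhds hφ.1 hφ.2)
  have hd1 : ∀ φ ∈ Ioo (0 : ℝ) (π / 2), HasDerivAt r₁ (p₂ φ) φ := fun φ hφ =>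
    (hp1 φ ⟨hφ.1.le, hφ.2⟩).hasDerivAt (Ico_mem_nhds hφ.1 hφ.2)
  have hcos : ∀ φ ∈ Ioo (0 : ℝ) (π / 2), 0 < Real.cos φ := fun φ hφ =>
    Real.cos_pos_of_mem_Ioo ⟨by linarith [hφ.1, Real.pi_pos], hφ.2⟩
  have hsin : ∀ φ ∈ Ioc (0 : ℝ) (π / 2), 0 < Real.sin φ := fun φ hφ =>
    Real.sin_pos_of_pos_of_lt_pi hφ.1 (by linarith [hφ.2])
  have hode' : ∀ φ ∈ Ioo (0 : ℝ) (π / 2),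
      Real.cos φ * p₂ φ = k * Real.sin φ * r₁ φ - ν * (ν + k) * r φ * Real.cos φ := by
    intro φ hφ
    have := hode φ ⟨hφ.1.le, hφ.2⟩
    have hc := (hcos φ hφ).ne'
    rw [Real.tan_eq_sin_div_cos] at this
    push_cast at this
    field_simp at this
    linear_combination this
  -- the divergence form
  have hdiv : ∀ φ ∈ Ioo (0 : ℝ) (π / 2),
      HasDerivAt (fun φ => Real.cos φ ^ k * r₁ φ) (-(ν * (ν + k)) * Real.cos φ ^ k * r φ) φ := by
    intro φ hφ
    refine (((Real.hasDerivAt_cos φ).pow k).mul (hd1 φ hφ)).congr_deriv ?_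
    have hc := (hcos φ hφ).ne'
    have := hode' φ hφ
    apply mul_left_cancel₀ hc
    rcases k with _ | k
    · simp at this ⊢
      linear_combination this
    · simp only [Nat.add_sub_cancel]
      push_cast at this ⊢
      simp only [Pi.pow_apply]
      linear_combination Real.cos φ ^ (k+1) * this
  set Δ := (1 - ν) * (ν + k + 1) with hΔ
  have hΔ0 : 0 ≤ Δ := mul_nonneg (by linarith) (by linarith)
  have hW : ∀ φ ∈ Ioo (0 : ℝ) (π / 2),
      HasDerivAt (fun φ => Real.cos φ ^ k * r₁ φ * Real.sin φ - Real.cos φ ^ (k + 1) * r φ)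
        (Δ * (Real.cos φ ^ k * r φ * Real.sin φ)) φ := by
    intro φ hφ
    refine (((hdiv φ hφ).mul (Real.hasDerivAt_sin φ)).sub
      (((Real.hasDerivAt_cos φ).pow (k + 1)).mul (hd φ hφ))).congr_deriv ?_
    simp only [Nat.add_sub_cancel, Pi.pow_apply, hΔ]
    push_cast
    ring
  have hWc : ContinuousOn
      (fun φ => Real.cos φ ^ k * r₁ φ * Real.sin φ - Real.cos φ ^ (k + 1) * r φ)
      (Icc 0 (π / 2)) := by fun_prop
  -- positivity propagates
  have key : ∀ a, 0 ≤ a → (∀ φ ∈ Ioc a (π / 2), 0 < r φ) →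
      ∀ φ ∈ Ioc a (π / 2), Real.sin φ ≤ r φ := by
    intro a ha hpos
    have hsubI : Icc a (π / 2) ⊆ Icc 0 (π / 2) := Icc_subset_Icc_left ha
    have hsubO : Ioo a (π / 2) ⊆ Ioo 0 (π / 2) := Ioo_subset_Ioo_left ha
    have mono : MonotoneOn
        (fun φ => Real.cos φ ^ k * r₁ φ * Real.sin φ - Real.cos φ ^ (k + 1) * r φ)
        (Icc a (π / 2)) := by
      refine monotoneOn_of_deriv_nonneg (convex_Icc _ _) (hWc.mono hsubI) ?_ ?_
      · rw [hI]; intro x hx; exact (hW x (hsubO hx)).differentiableAt.differentiableWithinAt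
      · rw [hI]; intro x hx
        rw [(hW x (hsubO hx)).deriv]
        have := hpos x ⟨hx.1, hx.2.le⟩
        have := hcos x (hsubO hx)
        have := hsin x ⟨(hsubO hx).1, hx.2.le⟩
        positivity
    have hWle : ∀ φ ∈ Ioo a (π / 2), r₁ φ * Real.sin φ - Real.cos φ * r φ ≤ 0 := by
      intro φ hφ
      have := mono ⟨hφ.1.le, hφ.2.le⟩ ⟨(hφ.1.trans hφ.2).le, le_rfl⟩ hφ.2.le
      simp [hr0] at this
      have hc := pow_pos (hcos φ (hsubO hφ)) k
      by_contra hcon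
      push Not at hcon
      have := mul_pos hc hcon
      rw [pow_succ] at *
      nlinarith
    intro φ hφ
    have hs := hsin φ ⟨ha.trans_lt hφ.1, hφ.2⟩
    have hsx : ∀ x ∈ Icc φ (π / 2), 0 < Real.sin x := fun x hx =>
      hsin x ⟨(ha.trans_lt hφ.1).trans_le hx.1, hx.2⟩
    have hsO : ∀ x ∈ Ioo φ (π / 2), x ∈ Ioo a (π / 2) := fun x hx => ⟨hφ.1.trans hx.1, hx.2⟩
    have hder : ∀ x ∈ Ioo φ (π / 2), HasDerivAt (fun x => r x / Real.sin x)
        ((r₁ x * Real.sin x - r x * Real.cos x) / Real.sin x ^ 2) x := fun x hx =>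
      (hd x (hsubO (hsO x hx))).div (Real.hasDerivAt_sin x) (hsx x ⟨hx.1.le, hx.2.le⟩).ne'
    have anti : AntitoneOn (fun x => r x / Real.sin x) (Icc φ (π / 2)) := by
      refine antitoneOn_of_deriv_nonpos (convex_Icc _ _) ?_ ?_ ?_
      · refine (hcp.mono (Icc_subset_Icc_left (ha.trans hφ.1.le))).div
          Real.continuous_sin.continuousOn fun x hx => (hsx x hx).ne'
      · rw [hI]; intro x hx; exact (hder x hx).differentiableAt.differentiableWithinAt
      · rw [hI]; intro x hx
        rw [(hder x hx).deriv]
        exact div_nonpos_of_nonpos_of_nonneg (by linarith [hWle x (hsO x hx)]) (sq_nonneg _)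
    have := anti ⟨le_rfl, hφ.2⟩ ⟨hφ.2, le_rfl⟩ hφ.2
    simp only [hr1, Real.sin_pi_div_two, div_one] at this
    rwa [le_div_iff₀ hs, one_mul] at this
  have lim : ∀ a, 0 ≤ a → a < π / 2 → (∀ φ ∈ Ioc a (π / 2), Real.sin φ ≤ r φ) →
      Real.sin a ≤ r a := by
    intro a ha ha2 hle
    have t : Tendsto r (nhdsWithin a (Ioo a (π / 2))) (nhds (r a)) :=
      (hcp a ⟨ha, ha2.le⟩).mono
        (fun x hx => ⟨ha.trans hx.1.le, hx.2.le⟩ : Ioo a (π / 2) ⊆ Icc 0 (π / 2))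
    have t2 : Tendsto Real.sin (nhdsWithin a (Ioo a (π / 2))) (nhds (Real.sin a)) :=
      Real.continuous_sin.continuousWithinAt
    rw [nhdsWithin_Ioo_eq_nhdsGT ha2] at t t2
    refine le_of_tendsto_of_tendsto t2 t ?_
    filter_upwards [Ioo_mem_nhdsGT ha2] with x hx
    exact hle x ⟨hx.1, hx.2.le⟩
  have hpos : ∀ φ ∈ Ioc 0 (π / 2), 0 < r φ := by
    by_contra hcon
    push Not at hcon
    obtain ⟨b, hb, hrb⟩ := hcon
    have hcl : IsCompact (Icc b (π / 2) ∩ r ⁻¹' Iic 0) := by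
      refine isCompact_Icc.of_isClosed_subset ?_ inter_subset_left
      exact (hcp.mono (Icc_subset_Icc_left hb.1.le)).preimage_isClosed_of_isClosed
        isClosed_Icc isClosed_Iic
    obtain ⟨a, ⟨ha1, ha2⟩, hamax⟩ := hcl.exists_isGreatest ⟨b, ⟨le_rfl, hb.2⟩, hrb⟩
    have ha2' : r a ≤ 0 := ha2
    have ha0 : 0 < a := hb.1.trans_le ha1.1
    have halt : a < π / 2 := by
      rcases eq_or_lt_of_le ha1.2 with he | hl
      · rw [he, hr1] at ha2'; linarith
      · exact hl
    have hp' : ∀ φ ∈ Ioc a (π / 2), 0 < r φ := by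
      intro φ hφ
      by_contra hc
      push Not at hc
      have := hamax ⟨⟨ha1.1.trans hφ.1.le, hφ.2⟩, hc⟩
      linarith [hφ.1]
    have := lim a ha0.le halt (key a ha0.le hp')
    linarith [hsin a ⟨ha0, ha1.2⟩]
  have hge := key 0 le_rfl hpos
  have hnn : 0 ≤ r 0 := by simpa using lim 0 le_rfl hpi hge
  have hlam : 0 ≤ ν * (ν + k) := by positivity
  -- `r₁ ≥ 0` hence `r ≤ 1`
  have anti1 : AntitoneOn (fun φ => Real.cos φ ^ k * r₁ φ) (Icc 0 (π / 2)) := by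
    refine antitoneOn_of_deriv_nonpos (convex_Icc _ _) (by fun_prop) ?_ ?_
    · rw [hI]; intro x hx; exact (hdiv x hx).differentiableAt.differentiableWithinAt
    · rw [hI]; intro x hx
      rw [(hdiv x hx).deriv]
      have := mul_nonneg hlam (mul_pos (pow_pos (hcos x hx) k) (hpos x ⟨hx.1, hx.2.le⟩)).le
      linarith
  have monr : MonotoneOn r (Icc 0 (π / 2)) := by
    refine monotoneOn_of_deriv_nonneg (convex_Icc _ _) hcp ?_ ?_
    · rw [hI]; intro x hx; exact (hd x hx).differentiableAt.differentiableWithinAt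
    · rw [hI]; intro x hx
      rw [(hd x hx).deriv]
      have := anti1 ⟨hx.1.le, hx.2.le⟩ ⟨hpi.le, le_rfl⟩ hx.2.le
      simp only [hr0, mul_zero] at this
      exact nonneg_of_mul_nonneg_right this (pow_pos (hcos x hx) k)
  have hle1 : ∀ φ ∈ Icc 0 (π / 2), r φ ≤ 1 := by
    intro φ hφ
    have := monr hφ ⟨hpi.le, le_rfl⟩ hφ.2
    rwa [hr1] at this
  refine ⟨hnn, ?_, ?_⟩
  · have hV : ∀ φ ∈ Ioo (0 : ℝ) (π / 2), HasDerivAt (fun φ =>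
        (Real.cos φ ^ k * r₁ φ * Real.sin φ - Real.cos φ ^ (k + 1) * r φ) - Δ * φ)
        (Δ * (Real.cos φ ^ k * r φ * Real.sin φ) - Δ * 1) φ := fun φ hφ =>
      (hW φ hφ).sub ((hasDerivAt_id φ).const_mul Δ)
    have anti : AntitoneOn (fun φ =>
        (Real.cos φ ^ k * r₁ φ * Real.sin φ - Real.cos φ ^ (k + 1) * r φ) - Δ * φ)
        (Icc 0 (π / 2)) := by
      refine antitoneOn_of_deriv_nonpos (convex_Icc _ _) (by fun_prop) ?_ ?_
      · rw [hI]; intro x hx; exact (hV x hx).differentiableAt.differentiableWithinAt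
      · rw [hI]; intro x hx
        rw [(hV x hx).deriv]
        have a1 := pow_le_one₀ (n := k) (hcos x hx).le (Real.cos_le_one x)
        have a2 := hle1 x ⟨hx.1.le, hx.2.le⟩
        have a3 := mul_le_one₀ a1 (hpos x ⟨hx.1, hx.2.le⟩).le a2
        have a4 := mul_le_one₀ a3 (hsin x ⟨hx.1, hx.2.le⟩).le (Real.sin_le_one x)
        have := mul_le_mul_of_nonneg_left a4 hΔ0
        linarith
    have := anti ⟨le_rfl, hpi.le⟩ ⟨hpi.le, le_rfl⟩ hpi.le
    simp [hr0] at this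
    have h2 : Δ ≤ (k + 2) * (1 - ν) := by
      rw [hΔ]; nlinarith
    nlinarith [mul_le_mul_of_nonneg_right h2 hpi.le]
  · have hG : ∀ φ ∈ Ioo (0 : ℝ) (π / 2), HasDerivAt (fun φ =>
        Real.cos φ ^ k * r₁ φ - ν * (ν + k) / (k + 1) * Real.cos φ ^ (k + 1))
        (-(ν * (ν + k)) * (Real.cos φ ^ k * (r φ - Real.sin φ))) φ := by
      intro φ hφ
      refine ((hdiv φ hφ).sub
        (((Real.hasDerivAt_cos φ).pow (k + 1)).const_mul _)).congr_deriv ?_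
      simp only [Nat.add_sub_cancel]
      push_cast
      field_simp
      ring
    have anti : AntitoneOn (fun φ =>
        Real.cos φ ^ k * r₁ φ - ν * (ν + k) / (k + 1) * Real.cos φ ^ (k + 1))
        (Icc 0 (π / 2)) := by
      refine antitoneOn_of_deriv_nonpos (convex_Icc _ _) (by fun_prop) ?_ ?_
      · rw [hI]; intro x hx; exact (hG x hx).differentiableAt.differentiableWithinAt
      · rw [hI]; intro x hx
        rw [(hG x hx).deriv]
        have a1 := hge x ⟨hx.1, hx.2.le⟩
        have := mul_nonneg hlam (mul_nonneg (pow_pos (hcos x hx) k).le (sub_nonneg.2 a1))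
        linarith
    have := anti ⟨le_rfl, hpi.le⟩ ⟨hpi.le, le_rfl⟩ hpi.le
    simp [hr0] at this
    linarith

lemma legendre_main (k j : ℕ) : ∀ μ : ℝ, (2 * j + 1 : ℝ) + 1 - 1 / 2 ≤ μ → μ ≤ (2 * j + 1) + 1 →
    ∀ p p₁ : ℝ → ℝ, IsLegendre (k + 2) μ p p₁ →
      p 0 ≠ 0 ∧ 0 ≤ -(p₁ 0) / p 0 ∧ -(p₁ 0) / p 0 ≤
        (2 * π * (k + 1) * (k + 2)) * (2 * j + 1) * ((2 * j + 1) + 1 - μ) := by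
  have hk : (0 : ℝ) ≤ k := Nat.cast_nonneg k
  induction j with
  | zero =>
    intro μ h1 h2 p p₁ hL
    simp only [Nat.cast_zero, mul_zero, zero_add] at h1 h2 ⊢
    have hμ : 0 < μ := by linarith
    obtain ⟨ha, hb, hc⟩ := legendre_base k (μ - 1) (by linarith) (by linarith) _ _
      (legendre_ladder k μ hμ.ne' p p₁ hL)
    simp only [Real.sin_zero, Real.cos_zero, zero_mul, one_mul, zero_add, zero_div, zero_sub]
      at ha hb hc
    have hA : 0 < μ + k - 1 := by linarith
    have hc' : (μ - 1) / (k + 1) ≤ -p 0 := by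
      have e : (μ - 1) * (μ - 1 + k) / (k + 1) = (μ + k - 1) * ((μ - 1) / (k + 1)) := by ring
      rw [e] at hc
      exact le_of_mul_le_mul_left hc hA
    have hq : 0 < (μ - 1) / (k + 1 : ℝ) := div_pos (by linarith) (by linarith)
    have hp0 : 0 < -p 0 := lt_of_lt_of_le hq hc'
    have hp1 : 0 ≤ p₁ 0 := by
      have := mul_nonneg ha hμ.le
      rwa [div_mul_cancel₀ _ hμ.ne'] at this
    have hE : -(p₁ 0) / p 0 = p₁ 0 / (-p 0) := by rw [neg_div, div_neg]
    refine ⟨by linarith, ?_, ?_⟩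
    · rw [hE]; positivity
    · rw [hE, div_le_iff₀ hp0]
      have hb' : p₁ 0 ≤ (k + 2) * (2 - μ) * (π / 2) * μ := by
        rw [div_le_iff₀ hμ] at hb
        linarith
      have hX : 0 ≤ (k + 2) * (2 - μ) * (π / 2) := by
        have := Real.pi_pos
        have : 0 ≤ 2 - μ := by linarith
        positivity
      have h3 : 1 / 2 ≤ (k + 1) * (-p 0) := by
        rw [div_le_iff₀ (by linarith)] at hc'
        linarith
      have h4 : μ ≤ 4 * ((k + 1) * (-p 0)) := by linarith
      calc p₁ 0 ≤ _ := hb'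
        _ ≤ (k + 2) * (2 - μ) * (π / 2) * (4 * ((k + 1) * (-p 0))) :=
          mul_le_mul_of_nonneg_left h4 hX
        _ = _ := by ring
  | succ j ih =>
    intro μ h1 h2 p p₁ hL
    push_cast at h1 h2 ⊢
    have hj : (0 : ℝ) ≤ j := Nat.cast_nonneg j
    have hμ : 0 < μ := by linarith
    have hμ1 : 0 < μ - 1 := by linarith
    have hL2 := legendre_ladder k (μ - 1) hμ1.ne' _ _ (legendre_ladder k μ hμ.ne' p p₁ hL)
    rw [sub_sub, one_add_one_eq_two] at hL2
    obtain ⟨ha, hb, hc⟩ := ih (μ - 2) (by linarith) (by linarith) _ _ hL2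
    simp only [Real.sin_zero, Real.cos_zero, zero_mul, one_mul, zero_add, zero_div, zero_sub]
      at ha hb hc
    have hA : 0 < μ + k - 1 := by linarith
    have hB : 0 < μ - 1 + k - 1 := by linarith
    have hp0 : p 0 ≠ 0 := by
      intro h0; apply ha; simp [h0]
    set R := μ * (μ + k - 1) / ((μ - 1 + k - 1) * (μ - 1)) with hR
    have hR0 : 0 ≤ R := by positivity
    have hE : -(p₁ 0) / p 0 =
        R * (-((μ - 1 + k - 1) * -(p₁ 0 / μ)) / ((μ + k - 1) * -p 0 / (μ - 1))) := by
      rw [hR]; field_simp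
    refine ⟨hp0, ?_, ?_⟩
    · rw [hE]; exact mul_nonneg hR0 hb
    · rw [hE]
      have hRle : R * (2 * j + 1) ≤ 2 * (j + 1) + 1 := by
        have hR2 : R = (μ / (μ - 1)) * ((μ + k - 1) / (μ - 1 + k - 1)) := by
          rw [hR]; field_simp
        have e1 : μ / (μ - 1) ≤ (2 * j + 3) / (2 * j + 2) := by
          rw [div_le_div_iff₀ hμ1 (by linarith)]; linarith
        have e2 : (μ + k - 1) / (μ - 1 + k - 1) ≤ (2 * j + 2) / (2 * j + 1) := by
          rw [div_le_div_iff₀ hB (by linarith)]; linarith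
        calc R * (2 * j + 1) ≤ ((2 * j + 3) / (2 * j + 2) * ((2 * j + 2) / (2 * j + 1)))
              * (2 * j + 1) := by
              rw [hR2]; gcongr
          _ = _ := by field_simp; ring
      have hY : 0 ≤ (2 * π * (k + 1) * (k + 2)) * (2 * (j + 1 : ℝ) + 1 + 1 - μ) := by
        have := Real.pi_pos
        have : 0 ≤ 2 * (j + 1 : ℝ) + 1 + 1 - μ := by linarith
        positivity
      calc _ ≤ _ := mul_le_mul_of_nonneg_left hc hR0
        _ = (R * (2 * j + 1)) *
            ((2 * π * (k + 1) * (k + 2)) * (2 * (j + 1 : ℝ) + 1 + 1 - μ)) := by ring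
        _ ≤ _ := mul_le_mul_of_nonneg_right hRle hY
        _ = _ := by ring

/-- **Proposition 2.1(c).** For every `n ≥ 2` there are `C > 0` and `δ ∈ (0,1)` depending
only on `n` such that for every odd positive `m` and `μ ∈ [m+1-δ, m+1]`, every Legendre
function for `(n, μ)` satisfies `p(0) ≠ 0` and `0 ≤ -p'(0)/p(0) ≤ C·m·(m+1-μ)`. -/
theorem legendre_upper_bound (n : ℕ) (hn : 2 ≤ n) :
    ∃ C : ℝ, 0 < C ∧ ∃ δ : ℝ, 0 < δ ∧ δ < 1 ∧
      ∀ m : ℕ, Odd m → 0 < m → ∀ μ : ℝ, (m : ℝ) + 1 - δ ≤ μ → μ ≤ m + 1 →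
        ∀ p p₁ : ℝ → ℝ, IsLegendre n μ p p₁ →
          p 0 ≠ 0 ∧ 0 ≤ -(p₁ 0) / p 0 ∧ -(p₁ 0) / p 0 ≤ C * m * ((m : ℝ) + 1 - μ) := by
  obtain ⟨k, rfl⟩ := Nat.exists_eq_add_of_le' hn
  refine ⟨2 * π * (k + 1) * (k + 2), by positivity, 1 / 2, by norm_num, by norm_num, ?_⟩
  rintro m ⟨j, rfl⟩ - μ h1 h2 p p₁ hL
  have := legendre_main k j μ (by push_cast at h1; linarith) (by push_cast at h2; linarith) p p₁ hL
  push_cast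
  exact this
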